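/- Let S be a finite type, let d : S → ℝ be a nonnegative state weighting, let u : S → ℝ, let K be a convex subset of the functions S → ℝ with the zero function in K, and let τ > 0. Then there exists h ∈ K with Σₛ d(s)·(2·u(s)·h(s) − h(s)²) > 0 if and only if there exists h ∈ K satisfying |h(s)| ≤ τ for all s and Σₛ d(s)·(2·u(s)·h(s) − h(s)²) > 0. Consequently, the supremum of Σₛ d(s)·(2·u(s)·h(s) − h(s)²) over h ∈ K is zero exactly when its supremum over the clipped class {h ∈ K : ∀s, |h(s)| ≤ τ} is zero, so the mean squared projected Bellman error and the mean Huber projected Bellman error with function class K share the same zero-error solutions. -/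

import Mathlib

/-- A bounded-above family containing the value `0` has supremum `0` iff no value is positive. -/
lemma Real.sSup_image_eq_zero_iff_not_exists_pos {α : Type*} {f : α → ℝ} {A : Set α}
    (hf : BddAbove (f '' A)) {a : α} (ha : a ∈ A) (hfa : f a = 0) :
    sSup (f '' A) = 0 ↔ ¬ ∃ x ∈ A, 0 < f x := by
  constructor
  · rintro h ⟨x, hx, hpos⟩
    exact (hpos.trans_le (le_csSup hf ⟨x, hx, rfl⟩)).ne' h
  · intro h
    push Not at h
    refine le_antisymm (csSup_le ⟨_, a, ha, rfl⟩ ?_) (le_csSup hf ⟨a, ha, hfa⟩)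
    rintro _ ⟨x, hx, rfl⟩
    exact h x hx

/-- Some positive multiple of `h`, by a factor at most `1`, takes values in `[-τ, τ]`. -/
lemma exists_pos_le_one_forall_abs_smul_le {S : Type*} [Fintype S] (h : S → ℝ) {τ : ℝ}
    (hτ : 0 < τ) : ∃ t : ℝ, 0 < t ∧ t ≤ 1 ∧ ∀ s, |(t • h) s| ≤ τ := by
  have hn := norm_nonneg h
  have hpos : 0 < τ + ‖h‖ := by positivity
  refine ⟨τ / (τ + ‖h‖), by positivity, (div_le_one hpos).2 (by linarith), fun s => ?_⟩
  have hs : |h s| ≤ ‖h‖ := norm_le_pi_norm h s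
  rw [Pi.smul_apply, smul_eq_mul, abs_mul, abs_of_pos (by positivity), div_mul_eq_mul_div,
    div_le_iff₀ hpos]
  gcongr
  linarith

/-- The conjugate objective is bounded by its value at `h = u`. -/
lemma sum_mul_two_mul_sub_sq_le {S : Type*} [Fintype S] {d : S → ℝ} (hd : ∀ s, 0 ≤ d s)
    (u h : S → ℝ) :
    ∑ s, d s * (2 * u s * h s - h s ^ 2) ≤ ∑ s, d s * u s ^ 2 :=
  Finset.sum_le_sum fun s _ =>
    mul_le_mul_of_nonneg_left (by nlinarith [sq_nonneg (u s - h s)]) (hd s)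

/-- The conjugate objective is superhomogeneous for factors in `[0, 1]`. -/
lemma mul_sum_le_sum_mul_two_mul_smul_sub_sq {S : Type*} [Fintype S] {d : S → ℝ}
    (hd : ∀ s, 0 ≤ d s) (u h : S → ℝ) {t : ℝ} (ht0 : 0 ≤ t) (ht1 : t ≤ 1) :
    t * ∑ s, d s * (2 * u s * h s - h s ^ 2) ≤
      ∑ s, d s * (2 * u s * (t • h) s - (t • h) s ^ 2) := by
  rw [Finset.mul_sum]
  refine Finset.sum_le_sum fun s _ => ?_
  rw [Pi.smul_apply, smul_eq_mul]
  have := mul_nonneg (mul_nonneg ht0 (sub_nonneg.2 ht1)) (mul_nonneg (hd s) (sq_nonneg (h s)))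
  linarith


/-- Positive conjugate objectives exist over a convex class `K` containing `0` iff they
exist over the `τ`-clipped subclass; consequently the supremum of the conjugate
(saddlepoint) objective over `K` (the MSPBE) is zero exactly when its supremum over
the clipped class (the MHPBE) is zero. -/
theorem mspbe_zero_iff_mhpbe_zero (S : Type*) [Fintype S] (d : S → ℝ)
    (hd : ∀ s, 0 ≤ d s) (u : S → ℝ) (K : Set (S → ℝ)) (hK : Convex ℝ K)
    (h0 : (0 : S → ℝ) ∈ K) (τ : ℝ) (hτ : 0 < τ) :
    ((∃ h ∈ K, 0 < ∑ s, d s * (2 * u s * h s - h s ^ 2)) ↔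
      (∃ h ∈ K, (∀ s, |h s| ≤ τ) ∧ 0 < ∑ s, d s * (2 * u s * h s - h s ^ 2))) ∧
    (sSup ((fun h : S → ℝ => ∑ s, d s * (2 * u s * h s - h s ^ 2)) '' K) = 0 ↔
      sSup ((fun h : S → ℝ => ∑ s, d s * (2 * u s * h s - h s ^ 2)) ''
        {h ∈ K | ∀ s, |h s| ≤ τ}) = 0) := by
  have hiff : (∃ h ∈ K, 0 < ∑ s, d s * (2 * u s * h s - h s ^ 2)) ↔
      (∃ h ∈ K, (∀ s, |h s| ≤ τ) ∧ 0 < ∑ s, d s * (2 * u s * h s - h s ^ 2)) := by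
    constructor
    · rintro ⟨h, hh, hpos⟩
      obtain ⟨t, ht0, ht1, hclip⟩ := exists_pos_le_one_forall_abs_smul_le h hτ
      exact ⟨t • h, hK.smul_mem_of_zero_mem h0 hh ⟨ht0.le, ht1⟩, hclip,
        (mul_pos ht0 hpos).trans_le
          (mul_sum_le_sum_mul_two_mul_smul_sub_sq hd u h ht0.le ht1)⟩
    · rintro ⟨h, hh, -, hpos⟩
      exact ⟨h, hh, hpos⟩
  have hbdd (A : Set (S → ℝ)) :
      BddAbove ((fun h : S → ℝ => ∑ s, d s * (2 * u s * h s - h s ^ 2)) '' A) := by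
    refine ⟨∑ s, d s * u s ^ 2, ?_⟩
    rintro _ ⟨h, -, rfl⟩
    exact sum_mul_two_mul_sub_sq_le hd u h
  have h0clip : (0 : S → ℝ) ∈ {h ∈ K | ∀ s, |h s| ≤ τ} := ⟨h0, fun s => by simpa using hτ.le⟩
  refine ⟨hiff, ?_⟩
  rw [Real.sSup_image_eq_zero_iff_not_exists_pos (hbdd _) h0 (by simp),
    Real.sSup_image_eq_zero_iff_not_exists_pos (hbdd _) h0clip (by simp), hiff]
  simp only [Set.mem_ofPred_eq, and_assoc]
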